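/- Let G = ⟨s₁,…,s_r⟩ be the free group of rank r, let ({P^s}_{s∈S}, π) be an invariant transition system with state space K, and let μ be the Borel probability measure on K^G induced by this transition system. Let α be the canonical partition of K^G and assume H(α) < ∞ and that the sums below converge absolutely. Then f(T,μ,α) = (2r−1) ∑_{i∈K} π_i log π_i − ∑_{s∈{s₁,…,s_r}} ∑_{i,j∈K} π_i P^s_{ij} log(π_i P^s_{ij}). -/

import Mathlib

open MeasureTheory Filter
open scoped ENNReal symmDiff

namespace Bowen

noncomputable section

/-- The free group of rank `r`. -/
abbrev FG (r : ℕ) := FreeGroup (Fin r)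

/-- The generating set element corresponding to `(i, b)`: `sᵢ` if `b = true`,
`sᵢ⁻¹` if `b = false`. -/
def gen {r : ℕ} (s : Fin r × Bool) : FG r :=
  cond s.2 (FreeGroup.of s.1) (FreeGroup.of s.1)⁻¹

/-- The symmetric generating set `S = {s₁^{±1},…,s_r^{±1}}`. -/
def Sset (r : ℕ) : Set (FG r) := Set.range (gen (r := r))

/-- The ball of radius `n` about the identity in the word metric of `(G,S)`. -/
def ball (r n : ℕ) : Set (FG r) := {g | FreeGroup.norm g ≤ n}

section Partitions

variable {X : Type*} [mX : MeasurableSpace X] {K L : Type*}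

/-- Shannon entropy of the countable labeled partition `p` with respect to `μ`
(in `ℝ≥0∞`, so that `H(p) < ∞` is meaningful). -/
def Hpart (μ : Measure X) (p : X → K) : ℝ≥0∞ :=
  ∑' k : K, ENNReal.ofReal (Real.negMulLog ((μ (p ⁻¹' {k})).toReal))

/-- The atom of the partition `p` containing `x`. -/
def atomOf (p : X → K) (x : X) : Set X := p ⁻¹' {p x}

/-- Conditional Shannon entropy of `p` given the sub-σ-algebra `m`:
`H(p|m) = ∫ -log( μ(A_x | m)(x) ) dμ(x)`. -/
def HpartC (μ : Measure X) (p : X → K) (m : MeasurableSpace X) : ℝ≥0∞ :=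
  ∫⁻ x, ENNReal.ofReal
    (- Real.log ((μ[(atomOf p x).indicator (fun _ => (1:ℝ)) | m]) x)) ∂μ

/-- Join of two labeled partitions. -/
def pjoin (p : X → K) (q : X → L) : X → K × L := fun x => (p x, q x)

/-- Pullback partition `T_g^{-1} p`. -/
def pull {r : ℕ} (T : FG r → X → X) (g : FG r) (p : X → K) : X → K :=
  fun x => p (T g x)

/-- The join `⋁_{q ∈ Q} T_q^{-1} p` over a set `Q ⊆ G`. -/
def powS {r : ℕ} (T : FG r → X → X) (p : X → K) (Q : Set (FG r)) : X → (Q → K) :=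
  fun x q => p (T (q : FG r) x)

/-- The join `p^n = ⋁_{g ∈ B(e,n)} T_g^{-1} p`. -/
def pow {r : ℕ} (T : FG r → X → X) (p : X → K) (n : ℕ) : X → (ball r n → K) :=
  powS T p (ball r n)

/-- The σ-algebra generated by the partition `p`. -/
def sAlg (p : X → K) : MeasurableSpace X := MeasurableSpace.comap p ⊤

/-- The smallest `G`-invariant σ-algebra containing the partition `p`. -/
def sAlgG {r : ℕ} (T : FG r → X → X) (p : X → K) : MeasurableSpace X :=
  ⨆ g : FG r, sAlg (pull T g p)

/-- The σ-algebra `⋁_{f ∈ Q} T_f^{-1} p` for a (possibly infinite) `Q ⊆ G`. -/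
def sAlgSet {r : ℕ} (T : FG r → X → X) (p : X → K) (Q : Set (FG r)) :
    MeasurableSpace X :=
  ⨆ f ∈ Q, sAlg (pull T f p)

/-- `F(T,α) = (1−2r)H(α) + ∑ᵢ H(α ∨ T_{sᵢ}^{-1}α)`. -/
def FF {r : ℕ} (T : FG r → X → X) (μ : Measure X) (p : X → K) : ℝ :=
  (1 - 2 * (r : ℝ)) * (Hpart μ p).toReal
    + ∑ i : Fin r, (Hpart μ (pjoin p (pull T (FreeGroup.of i) p))).toReal

/-- `f(T,α) = inf_{n>0} F(T,α^n)`, as an extended real. -/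
def littleF {r : ℕ} (T : FG r → X → X) (μ : Measure X) (p : X → K) : EReal :=
  ⨅ n : ℕ, ((FF T μ (pow T p (n + 1)) : ℝ) : EReal)

/-- Conditional version `F(T,α|𝓕) = (1−2r)H(α|𝓕) + ∑ᵢ H(α ∨ T_{sᵢ}^{-1}α|𝓕)`. -/
def FFc {r : ℕ} (T : FG r → X → X) (μ : Measure X) (m : MeasurableSpace X)
    (p : X → K) : ℝ :=
  (1 - 2 * (r : ℝ)) * (HpartC (mX := mX) μ p m).toReal
    + ∑ i : Fin r, (HpartC (mX := mX) μ (pjoin p (pull T (FreeGroup.of i) p)) m).toReal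

/-- Conditional `f(T,α|𝓕) = inf_{n>0} F(T,α^n|𝓕)`. -/
def littleFc {r : ℕ} (T : FG r → X → X) (μ : Measure X) (m : MeasurableSpace X)
    (p : X → K) : EReal :=
  ⨅ n : ℕ, ((FFc (mX := mX) T μ m (pow T p (n + 1)) : ℝ) : EReal)

/-- The mean entropy `h(T_s, α) = lim_n H(⋁_{i=0}^n T_s^{-i}α)/(n+1)`; since the
sequence is subadditive the limit equals the infimum, which we take as the
definition. -/
def hrate {r : ℕ} (T : FG r → X → X) (μ : Measure X) (s : FG r) (p : X → K) : ℝ :=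
  ⨅ n : ℕ, (Hpart μ (fun x (i : Fin (n + 1)) => p (T (s ^ (i : ℕ)) x))).toReal / (n + 1)

/-- Conditional mean entropy `h(T_s, α|𝓕) = lim_n H(⋁_{i=0}^n T_s^{-i}α | 𝓕)/(n+1)`;
for an invariant `𝓕` the sequence is subadditive so the limit equals the infimum. -/
def hrateC {r : ℕ} (T : FG r → X → X) (μ : Measure X) (m : MeasurableSpace X)
    (s : FG r) (p : X → K) : ℝ :=
  ⨅ n : ℕ, (HpartC (mX := mX) μ (fun x (i : Fin (n + 1)) => p (T (s ^ (i : ℕ)) x)) m).toReal / (n + 1)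

/-- `F_*(T,α) = (1−r)H(α) + ∑ᵢ h(T_{sᵢ},α)`. -/
def Fstar {r : ℕ} (T : FG r → X → X) (μ : Measure X) (p : X → K) : ℝ :=
  (1 - (r : ℝ)) * (Hpart μ p).toReal + ∑ i : Fin r, hrate T μ (FreeGroup.of i) p

/-- `f_*(T,α) = inf_{n>0} F_*(T,α^n)`. -/
def fstar {r : ℕ} (T : FG r → X → X) (μ : Measure X) (p : X → K) : EReal :=
  ⨅ n : ℕ, ((Fstar T μ (pow T p (n + 1)) : ℝ) : EReal)

/-- `F_*(T,α|𝓕) = (1−r)H(α|𝓕) + ∑ᵢ h(T_{sᵢ},α|𝓕)`. -/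
def FstarC {r : ℕ} (T : FG r → X → X) (μ : Measure X) (m : MeasurableSpace X)
    (p : X → K) : ℝ :=
  (1 - (r : ℝ)) * (HpartC (mX := mX) μ p m).toReal + ∑ i : Fin r, hrateC (mX := mX) T μ m (FreeGroup.of i) p

/-- `f_*(T,α|𝓕) = inf_{n>0} F_*(T,α^n|𝓕)`. -/
def fstarC {r : ℕ} (T : FG r → X → X) (μ : Measure X) (m : MeasurableSpace X)
    (p : X → K) : EReal :=
  ⨅ n : ℕ, ((FstarC (mX := mX) T μ m (pow T p (n + 1)) : ℝ) : EReal)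

/-- `p` refines `q`: each atom of `p` is contained, up to a `μ`-null set,
in an atom of `q`. -/
def Refines (μ : Measure X) (p : X → K) (q : X → L) : Prop :=
  ∀ k : K, ∃ l : L, μ (p ⁻¹' {k} \ q ⁻¹' {l}) = 0

/-- Two labeled partitions are equal as partitions (up to null sets). -/
def PartEquiv (μ : Measure X) (p : X → K) (q : X → L) : Prop :=
  Refines μ p q ∧ Refines μ q p

/-- `σ` is a simple splitting of `p`: `σ = p ∨ T_s^{-1}β` for some `s ∈ S` and
some coarsening `β` of `p`. -/
def SimpleSplit {r : ℕ} (μ : Measure X) (T : FG r → X → X) (p σ : X → ℕ) : Prop :=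
  ∃ s ∈ Sset r, ∃ β : X → ℕ, Measurable β ∧ Refines μ p β ∧
    PartEquiv μ σ (pjoin p (pull T s β))

/-- `τ` is a splitting of `p`: obtained from `p` by a finite sequence of simple
splittings (as a partition, i.e. up to relabeling and null sets). -/
def IsSplitting {r : ℕ} (μ : Measure X) (T : FG r → X → X) (p : X → ℕ)
    (τ : X → K) : Prop :=
  ∃ σ : X → ℕ, Relation.ReflTransGen (SimpleSplit μ T) p σ ∧ PartEquiv μ σ τ

/-- A partition is generating if the smallest `G`-invariant σ-algebra containing it
is the full σ-algebra up to `μ`-null sets. -/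
def Generating {r : ℕ} (T : FG r → X → X) (μ : Measure X) (p : X → K) : Prop :=
  ∀ A : Set X, MeasurableSet A →
    ∃ A' : Set X, MeasurableSet[sAlgG T p] A' ∧ μ (A ∆ A') = 0

/-- The Rohlin distance `d(α,β) = H(α|β) + H(β|α)`. -/
def rohlinDist (μ : Measure X) (p : X → K) (q : X → L) : ℝ :=
  (HpartC μ p (sAlg q)).toReal + (HpartC μ q (sAlg p)).toReal

end Partitions

/-- Adjacency in the left Cayley graph `Γ_L`: an edge joins `a` and `sa`, `s ∈ S`. -/
def adjL {r : ℕ} (a b : FG r) : Prop := ∃ s ∈ Sset r, b = s * a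

/-- `Past(g₁;g₂)`: the set of `f ∈ G` such that every path in the left Cayley
graph from `f` to `g₁` passes through `g₂`. -/
def Past {r : ℕ} (g₁ g₂ : FG r) : Set (FG r) :=
  {f | ∀ l : List (FG r), l ≠ [] → l.head? = some f → l.getLast? = some g₁ →
        l.Chain' adjL → g₂ ∈ l}

/-- A subset `F ⊆ G` is right-connected: the subgraph of the right Cayley graph
induced on `F` is connected. -/
def RightConnected {r : ℕ} (F : Set (FG r)) : Prop :=
  ∀ g ∈ F, ∀ h ∈ F,
    Relation.ReflTransGen (fun a b => a ∈ F ∧ b ∈ F ∧ ∃ s ∈ Sset r, b = a * s) g h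

/-- A subset `F ⊆ G` is left-connected: the subgraph of the left Cayley graph
induced on `F` is connected. -/
def LeftConnected {r : ℕ} (F : Set (FG r)) : Prop :=
  ∀ g ∈ F, ∀ h ∈ F,
    Relation.ReflTransGen (fun a b => a ∈ F ∧ b ∈ F ∧ ∃ s ∈ Sset r, b = s * a) g h

section Markov

variable {X : Type*} [MeasurableSpace X] {K : Type*}

/-- A `G`-process `(T,X,μ,α)` is Markov: for every `s ∈ S`, `g ∈ G` and every atom
`A` of `α`, `μ(T_{sg}^{-1}A | ⋁_{f∈Past(sg;g)} T_f^{-1}α) = μ(T_{sg}^{-1}A | T_g^{-1}α)`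
almost everywhere. -/
def IsMarkov {r : ℕ} (μ : Measure X) (T : FG r → X → X) (p : X → K) : Prop :=
  ∀ s ∈ Sset r, ∀ g : FG r, ∀ k : K,
    (μ[((pull T (s * g) p) ⁻¹' {k}).indicator (fun _ => (1:ℝ)) |
        sAlgSet T p (Past (s * g) g)])
      =ᵐ[μ]
    (μ[((pull T (s * g) p) ⁻¹' {k}).indicator (fun _ => (1:ℝ)) |
        sAlg (pull T g p)])

end Markov


section ExtraDefs

/-- The distance `d₁` between two ordered processes:
`∑_{s∈S} ∑_{i,j} |μ(A_i ∩ T_s^{-1}A_j) − ν(B_i ∩ U_s^{-1}B_j)|`. -/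
def d1 {X Y : Type*} [MeasurableSpace X] [MeasurableSpace Y] {r : ℕ}
    (T : FG r → X → X) (μ : Measure X) (α : X → ℕ)
    (U : FG r → Y → Y) (ν : Measure Y) (β : Y → ℕ) : ℝ :=
  ∑ i : Fin r, ∑ b : Bool,
    ∑' ij : ℕ × ℕ,
      |(μ (α ⁻¹' {ij.1} ∩ pull T (gen (i, b)) α ⁻¹' {ij.2})).toReal -
        (ν (β ⁻¹' {ij.1} ∩ pull U (gen (i, b)) β ⁻¹' {ij.2})).toReal|

/-- Isomorphism of ordered processes: a measure conjugacy between conull sets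
intertwining the actions and carrying the `i`-th atom to the `i`-th atom. -/
def OrderedIso {X Y : Type*} [MeasurableSpace X] [MeasurableSpace Y] {r : ℕ}
    (T : FG r → X → X) (μ : Measure X) (α : X → ℕ)
    (U : FG r → Y → Y) (ν : Measure Y) (β : Y → ℕ) : Prop :=
  ∃ (X' : Set X) (Y' : Set Y) (φ : X → Y) (ψ : Y → X),
    MeasurableSet X' ∧ MeasurableSet Y' ∧ μ X'ᶜ = 0 ∧ ν Y'ᶜ = 0 ∧
    Measurable φ ∧ Measurable ψ ∧ Set.MapsTo φ X' Y' ∧ Set.MapsTo ψ Y' X' ∧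
    (∀ x ∈ X', ψ (φ x) = x) ∧ (∀ y ∈ Y', φ (ψ y) = y) ∧
    Measure.map φ μ = ν ∧
    (∀ (g : FG r), ∀ x ∈ X', φ (T g x) = U g (φ x)) ∧
    (∀ x ∈ X', β (φ x) = α x)

/-- A transition system for `(G,S)`: a family of `K × K` matrices indexed by the
generating set together with a row vector, written as functions. -/
structure TransSys (r : ℕ) (K : Type*) where
  P : Fin r × Bool → K → K → ℝ
  pi : K → ℝ

/-- The transition system is an invariant transition system: the `P^s` are
stochastic matrices, `π` is a probability vector which is a steady state vector
for every `P^s`, and `π_i P^{s^{-1}}_{ij} = π_j P^s_{ji}`. -/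
def TransSys.IsInvariant {r : ℕ} {K : Type*} (ts : TransSys r K) : Prop :=
  (∀ s i j, 0 ≤ ts.P s i j) ∧ (∀ s i, HasSum (ts.P s i) 1) ∧
    (∀ i, 0 ≤ ts.pi i) ∧ HasSum ts.pi 1 ∧
    (∀ s j, HasSum (fun i => ts.pi i * ts.P s i j) (ts.pi j)) ∧
    (∀ s i j, ts.pi i * ts.P (s.1, !s.2) i j = ts.pi j * ts.P s j i)

/-- The canonical (shift) action of `G` on `K^G`: `(T_g x)(f) = x(fg)`. -/
def shiftT {r : ℕ} {K : Type*} : FG r → (FG r → K) → (FG r → K) :=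
  fun g x f => x (f * g)

/-- `μ` is (a measure) induced by the transition system `ts`: the time-`e`
distribution is `π` and the transition probabilities into the complement of the
past are given by the matrices `P^s`.  (Note `T_g^{-1}A_k = {x : x(g) = k}`;
the conditional equalities `μ(A|B) = c` are recorded in the equivalent product
form `μ(A ∩ B) = c·μ(B)`.) -/
def IsInducedBy {r : ℕ} {K : Type*} [MeasurableSpace K]
    (μ : Measure (FG r → K)) (ts : TransSys r K) : Prop :=
  (∀ k : K, μ {x | x 1 = k} = ENNReal.ofReal (ts.pi k)) ∧
  ∀ (s : Fin r × Bool) (g : FG r),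
    FreeGroup.norm (gen s * g) = FreeGroup.norm g + 1 →
    ∀ (n : ℕ) (fs : Fin n → FG r) (ks : Fin n → K) (k₀ k : K),
      (∀ i, fs i ∈ Past (gen s * g) g ∧ fs i ≠ g) →
      (μ ({x | x (gen s * g) = k} ∩ ({x | x g = k₀} ∩ ⋂ i, {x | x (fs i) = ks i}))
          = ENNReal.ofReal (ts.P s k₀ k) * μ ({x | x g = k₀} ∩ ⋂ i, {x | x (fs i) = ks i})) ∧
      μ ({x | x (gen s * g) = k} ∩ {x | x g = k₀})
          = ENNReal.ofReal (ts.P s k₀ k) * μ {x | x g = k₀}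

end ExtraDefs


/-! ### Combinatorics of the free group -/

lemma gen_eq_mk {r : ℕ} (s : Fin r × Bool) : gen s = FreeGroup.mk [s] := by
  rcases s with ⟨i, b⟩
  cases b
  · simp [gen, FreeGroup.of, FreeGroup.inv_mk, FreeGroup.invRev]
  · simp [gen, FreeGroup.of]

lemma norm_gen {r : ℕ} (s : Fin r × Bool) : FreeGroup.norm (gen s) = 1 := by
  rw [gen_eq_mk]; simp [FreeGroup.norm]

lemma gen_inv {r : ℕ} (s : Fin r × Bool) : (gen s)⁻¹ = gen (s.1, !s.2) := by
  rcases s with ⟨i, b⟩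
  cases b <;> simp [gen]

lemma toWord_gen_mul {r : ℕ} (s : Fin r × Bool) (g : FG r) :
    (gen s * g).toWord = s :: g.toWord ∨ g.toWord = (s.1, !s.2) :: (gen s * g).toWord := by
  have h : (gen s * g).toWord = FreeGroup.reduce (s :: g.toWord) := by
    conv_lhs => rw [gen_eq_mk, ← FreeGroup.mk_toWord (x := g)]
    simp [FreeGroup.mul_mk, -FreeGroup.reduce.cons]
  rw [FreeGroup.reduce.cons, FreeGroup.reduce_toWord] at h
  cases hw : g.toWord with
  | nil => left; simpa [hw] using h
  | cons a w =>
    rw [hw] at h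
    by_cases hc : s.1 = a.1 ∧ s.2 = !a.2
    · right
      simp only [hc, and_self, if_true] at h
      rw [h]
      rcases a with ⟨a1, a2⟩
      simp [hc.1, hc.2]
    · left
      simpa [hc] using h

lemma norm_gen_mul {r : ℕ} (s : Fin r × Bool) (g : FG r) :
    FreeGroup.norm (gen s * g) = FreeGroup.norm g + 1 ∨
      FreeGroup.norm g = FreeGroup.norm (gen s * g) + 1 := by
  rcases toWord_gen_mul s g with h | h
  · left; simp [FreeGroup.norm, h]
  · right; simp [FreeGroup.norm, h]

lemma toWord_gen_mul_of_norm {r : ℕ} {s : Fin r × Bool} {g : FG r}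
    (hn : FreeGroup.norm (gen s * g) = FreeGroup.norm g + 1) :
    (gen s * g).toWord = s :: g.toWord := by
  rcases toWord_gen_mul s g with h | h
  · exact h
  · exfalso
    have : FreeGroup.norm g = FreeGroup.norm (gen s * g) + 1 := by
      simp [FreeGroup.norm, h]
    omega

lemma exists_parent {r : ℕ} {h : FG r} (hh : h ≠ 1) :
    ∃ s g, h = gen s * g ∧ FreeGroup.norm h = FreeGroup.norm g + 1 := by
  cases hw : h.toWord with
  | nil => exact absurd (FreeGroup.toWord_eq_nil_iff.mp hw) hh
  | cons a w =>
    refine ⟨a, gen (a.1, !a.2) * h, ?_, ?_⟩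
    · rw [← gen_inv]; simp
    · rcases toWord_gen_mul (a.1, !a.2) h with h1 | h1
      · exfalso
        have h2 := FreeGroup.isReduced_toWord (x := gen (a.1, !a.2) * h)
        rw [h1, hw] at h2
        rw [FreeGroup.isReduced_cons_cons] at h2
        simp at h2
      · simp [FreeGroup.norm, h1]

lemma norm_mul_gen {r : ℕ} (s : Fin r × Bool) (g : FG r) :
    FreeGroup.norm (g * gen s) = FreeGroup.norm g + 1 ∨
      FreeGroup.norm g = FreeGroup.norm (g * gen s) + 1 := by
  have := norm_gen_mul (s.1, !s.2) g⁻¹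
  rw [← gen_inv, ← mul_inv_rev, FreeGroup.norm_inv_eq, FreeGroup.norm_inv_eq] at this
  exact this

/-- the unique letter at the end of a nontrivial element -/
lemma exists_last {r : ℕ} {h : FG r} (hh : h ≠ 1) :
    ∃ s : Fin r × Bool, ∀ t : Fin r × Bool,
      FreeGroup.norm (h * (gen t)⁻¹) + 1 = FreeGroup.norm h ↔ t = s := by
  obtain ⟨s, g, hs, hn⟩ := exists_parent (h := h⁻¹) (by simpa using hh)
  have hw := toWord_gen_mul_of_norm (s := s) (g := g) (by rw [← hs, hn])
  refine ⟨(s.1, !s.2), fun t => ?_⟩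
  have e : FreeGroup.norm (h * (gen t)⁻¹) = FreeGroup.norm (gen t * h⁻¹) := by
    rw [← FreeGroup.norm_inv_eq]; simp
  rw [e, ← FreeGroup.norm_inv_eq (x := h)]
  constructor
  · intro h1
    rcases toWord_gen_mul t h⁻¹ with h2 | h2
    · simp [FreeGroup.norm, h2] at h1
      omega
    · rw [hs, hw] at h2
      have h3 := (List.cons.inj h2).1
      rw [h3]; simp
  · rintro rfl
    rw [hn, ← gen_inv, hs]; simp

/-- first-letter weight -/
def wt {r : ℕ} {M : Type*} [Zero M] (c : Fin r → M) (g : FG r) : M :=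
  match g.toWord with
  | [] => 0
  | a :: _ => c a.1

lemma wt_one {r : ℕ} {M : Type*} [Zero M] (c : Fin r → M) : wt c (1 : FG r) = 0 := by
  simp [wt]

lemma wt_gen_mul {r : ℕ} {M : Type*} [Zero M] (c : Fin r → M) {s : Fin r × Bool} {g : FG r}
    (hn : FreeGroup.norm (gen s * g) = FreeGroup.norm g + 1) :
    wt c (gen s * g) = c s.1 := by
  simp [wt, toWord_gen_mul_of_norm hn]

lemma wt_mul_gen {r : ℕ} {M : Type*} [Zero M] (c : Fin r → M) {s : Fin r × Bool} {g : FG r}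
    (hg : g ≠ 1)
    (hn : FreeGroup.norm (g * gen s) = FreeGroup.norm g + 1) :
    wt c (g * gen s) = wt c g := by
  obtain ⟨t, g', rfl, h1⟩ := exists_parent hg
  rw [wt_gen_mul c h1, mul_assoc, wt_gen_mul]
  have h2 := norm_gen_mul t (g' * gen s)
  have h3 := norm_mul_gen s g'
  rw [mul_assoc] at hn
  omega

lemma ball_finite (r n : ℕ) : (ball r n).Finite := by
  have h : (FreeGroup.toWord '' ball r n).Finite := by
    apply (List.finite_length_le (Fin r × Bool) n).subset
    rintro _ ⟨g, hg, rfl⟩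
    exact hg
  exact h.of_finite_image FreeGroup.toWord_injective.injOn

/-- ball as a finset -/
def bf (r n : ℕ) : Finset (FG r) := (ball_finite r n).toFinset

lemma mem_bf {r n : ℕ} {g : FG r} : g ∈ bf r n ↔ FreeGroup.norm g ≤ n := by
  simp [bf, ball]

/-- sphere as a finset -/
def sf (r n : ℕ) : Finset (FG r) := (bf r n).filter (fun g => FreeGroup.norm g = n)

lemma mem_sf {r n : ℕ} {g : FG r} : g ∈ sf r n ↔ FreeGroup.norm g = n := by
  simp only [sf, Finset.mem_filter, mem_bf]; omega

lemma sum_bf_succ {r n : ℕ} (w : FG r → ℝ) :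
    ∑ g ∈ bf r (n+1), w g = ∑ g ∈ bf r n, w g + ∑ g ∈ sf r (n+1), w g := by
  rw [← Finset.sum_union]
  · apply Finset.sum_congr _ (fun _ _ => rfl)
    ext g; simp only [Finset.mem_union, mem_bf, mem_sf]; omega
  · rw [Finset.disjoint_left]; intro g; simp only [mem_bf, mem_sf]; omega

/-- elements of the sphere ending with the given letter -/
def lf (r n : ℕ) (j : Fin r) : Finset (FG r) :=
  (sf r (n+1)).filter (fun g => FreeGroup.norm (g * (gen (j, true))⁻¹) = n)

lemma mem_lf {r n : ℕ} {j : Fin r} {g : FG r} : g ∈ lf r n j ↔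
    FreeGroup.norm g = n + 1 ∧ FreeGroup.norm (g * (gen (j, true))⁻¹) = n := by
  simp [lf, mem_sf]

lemma sum_last {r n : ℕ} (c : Fin r → ℝ) :
    ∑ j, ∑ g ∈ lf r n j, wt c g = ∑ j, c j + (r - 1) * ∑ g ∈ bf r n, wt c g := by
  induction n with
  | zero =>
    have h1 : ∑ g ∈ bf r 0, wt c g = 0 := by
      apply Finset.sum_eq_zero
      intro g hg
      rw [mem_bf, Nat.le_zero, FreeGroup.norm_eq_zero] at hg
      rw [hg, wt_one]
    rw [h1, mul_zero, add_zero]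
    apply Finset.sum_congr rfl
    intro j _
    have : lf r 0 j = {gen (j, true)} := by
      ext g
      rw [mem_lf, Finset.mem_singleton, FreeGroup.norm_eq_zero, mul_inv_eq_one]
      constructor
      · exact fun h => h.2
      · rintro rfl; exact ⟨norm_gen _, rfl⟩
    rw [this, Finset.sum_singleton]
    have := wt_gen_mul c (s := (j, true)) (g := 1) (by simp [norm_gen])
    simpa using this
  | succ n ih =>
    have h1 : ∀ j, ∑ g ∈ lf r (n+1) j, wt c g =
        ∑ h ∈ sf r (n+1), if FreeGroup.norm (h * gen (j, true)) = n + 2 then wt c h else 0 := by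
      intro j
      rw [← Finset.sum_filter]
      refine Finset.sum_nbij' (fun g => g * (gen (j, true))⁻¹) (fun g => g * gen (j, true))
        ?_ ?_ ?_ ?_ ?_
      · intro g hg
        rw [mem_lf] at hg
        simp only [Finset.mem_filter, mem_sf, inv_mul_cancel_right]
        exact ⟨hg.2, hg.1⟩
      · intro g hg
        simp only [Finset.mem_filter, mem_sf] at hg
        rw [mem_lf]
        simp [hg]
      · intro g _; simp
      · intro g _; simp
      · intro g hg
        rw [mem_lf] at hg
        conv_lhs => rw [← inv_mul_cancel_right g (gen (j, true))]
        apply wt_mul_gen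
        · intro h; rw [h] at hg; simp at hg
        · simp [hg]
    have h2 : ∀ j, ∑ g ∈ lf r n j, wt c g =
        ∑ h ∈ sf r (n+1), if FreeGroup.norm (h * (gen (j, true))⁻¹) = n then wt c h else 0 := by
      intro j
      rw [← Finset.sum_filter]; rfl
    have h3 : ∑ j, ∑ g ∈ lf r (n+1) j, wt c g = ∑ j, ∑ g ∈ lf r n j, wt c g
        + (r - 1) * ∑ g ∈ sf r (n+1), wt c g := by
      simp_rw [h1, h2]
      rw [Finset.sum_comm, Finset.sum_comm (s := Finset.univ), Finset.mul_sum,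
        ← Finset.sum_add_distrib]
      apply Finset.sum_congr rfl
      intro h hh
      rw [mem_sf] at hh
      obtain ⟨⟨i, b⟩, hs⟩ := exists_last (h := h) (by rintro rfl; simp at hh)
      have e1 : ∀ j, (FreeGroup.norm (h * gen (j, true)) = n + 2) ↔ ¬ ((j, false) = (i, b)) := by
        intro j
        have hg : (gen (j, false))⁻¹ = gen (j, true) := gen_inv (j, false)
        rw [← hs, hg]
        have := norm_mul_gen (j, true) h
        omega
      have e2 : ∀ j, (FreeGroup.norm (h * (gen (j, true))⁻¹) = n) ↔ (j, true) = (i, b) := by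
        intro j
        rw [← hs]; omega
      simp_rw [e1, e2]
      have e3 : ∀ j, (if ¬ ((j, false) = (i, b)) then wt c h else 0)
          = wt c h - (if (j, false) = (i, b) then wt c h else 0) := by
        intro j; split_ifs <;> simp_all
      simp_rw [e3]
      cases b <;> simp [Prod.ext_iff] <;> ring
    rw [h3, ih, sum_bf_succ]
    ring

lemma mem_past {r : ℕ} {s : Fin r × Bool} {g f : FG r}
    (hn : FreeGroup.norm (gen s * g) = FreeGroup.norm g + 1)
    (hf : FreeGroup.norm f ≤ FreeGroup.norm (gen s * g)) (hne : f ≠ gen s * g) :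
    f ∈ Past (gen s * g) g := by
  have key : ∀ l : List (FG r), ∀ f : FG r, ¬ ((gen s * g).toWord <:+ f.toWord) →
      l.head? = some f → l.getLast? = some (gen s * g) → l.IsChain adjL → g ∈ l := by
    intro l
    induction l with
    | nil => intro f _ h; simp at h
    | cons a l ih =>
      intro f hfs h1 h2 h3
      simp only [List.head?_cons, Option.some.injEq] at h1
      subst h1
      cases l with
      | nil =>
        exfalso
        simp only [List.getLast?_singleton, Option.some.injEq] at h2
        subst h2
        exact hfs (List.suffix_refl _)
      | cons b l =>
        rw [List.isChain_cons_cons] at h3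
        by_cases hb : (gen s * g).toWord <:+ b.toWord
        · obtain ⟨_, ⟨t, rfl⟩, rfl⟩ := h3.1
          rcases toWord_gen_mul t a with h4 | h4
          · rw [h4, List.suffix_cons_iff] at hb
            rcases hb with hb | hb
            · rw [toWord_gen_mul_of_norm hn] at hb
              have := FreeGroup.toWord_injective (List.cons.inj hb).2
              rw [this]; simp
            · exact absurd hb hfs
          · exfalso
            apply hfs
            rw [h4]
            exact hb.trans (List.suffix_cons _ _)
        · refine List.mem_cons_of_mem _ (ih b hb (by simp) ?_ h3.2)
          simpa using h2
  intro l _ h1 h2 h3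
  refine key l f ?_ h1 h2 h3
  intro h
  apply hne
  apply FreeGroup.toWord_injective
  exact (h.eq_of_length_le hf).symm

/-! ### Entropy -/

lemma Hpart_comp {X : Type*} [MeasurableSpace X] {L M : Type*} (μ : Measure X) (p : X → L)
    (ι : L → M) (hι : Function.Injective ι) : Hpart μ (fun x => ι (p x)) = Hpart μ p := by
  unfold Hpart
  rw [← hι.tsum_eq]
  · apply tsum_congr
    intro l
    congr 4
    ext x
    simp [hι.eq_iff]
  · intro m hm
    by_contra h
    apply hm
    have : (fun x => ι (p x)) ⁻¹' {m} = ∅ := by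
      ext x
      simp only [Set.mem_preimage, Set.mem_singleton_iff, Set.mem_empty_iff_false, iff_false]
      rintro rfl
      exact h ⟨_, rfl⟩
    simp [this]

/-- conditional entropy of one step -/
def hstep {r : ℕ} {K : Type*} (ts : TransSys r K) (s : Fin r × Bool) : ℝ≥0∞ :=
  ∑' i, ENNReal.ofReal (ts.pi i) * ∑' k, ENNReal.ofReal (Real.negMulLog (ts.P s i k))

section Step
variable {r : ℕ} {K : Type*}

lemma P_le_one {ts : TransSys r K} (hts : ts.IsInvariant) (s : Fin r × Bool) (i j : K) :
    ts.P s i j ≤ 1 :=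
  le_hasSum (hts.2.1 s i) j (fun _ _ => hts.1 _ _ _)

lemma pi_le_one {ts : TransSys r K} (hts : ts.IsInvariant) (i : K) : ts.pi i ≤ 1 :=
  le_hasSum hts.2.2.2.1 i (fun _ _ => hts.2.2.1 _)

lemma tsum_P {ts : TransSys r K} (hts : ts.IsInvariant) (s : Fin r × Bool) (i : K) :
    ∑' k, ENNReal.ofReal (ts.P s i k) = 1 := by
  rw [← ENNReal.ofReal_tsum_of_nonneg (hts.1 s i) (hts.2.1 s i).summable, (hts.2.1 s i).tsum_eq]
  simp

lemma tsum_pi_P {ts : TransSys r K} (hts : ts.IsInvariant) (s : Fin r × Bool) (k : K) :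
    ∑' i, ENNReal.ofReal (ts.P s i k) * ENNReal.ofReal (ts.pi i) = ENNReal.ofReal (ts.pi k) := by
  have h := hts.2.2.2.2.1 s k
  rw [← h.tsum_eq, ENNReal.ofReal_tsum_of_nonneg
    (fun i => mul_nonneg (hts.2.2.1 i) (hts.1 s i k)) h.summable]
  apply tsum_congr
  intro i
  rw [mul_comm, ENNReal.ofReal_mul (hts.2.2.1 i)]

/-- row computation -/
lemma tsum_row {ts : TransSys r K} (hts : ts.IsInvariant) (s : Fin r × Bool) (i : K)
    (m : ℝ) (h0 : 0 ≤ m) (h1 : m ≤ 1) :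
    ∑' k, ENNReal.ofReal (Real.negMulLog (m * ts.P s i k)) =
      ENNReal.ofReal (Real.negMulLog m) +
        ENNReal.ofReal m * ∑' k, ENNReal.ofReal (Real.negMulLog (ts.P s i k)) := by
  have e : ∀ k, ENNReal.ofReal (Real.negMulLog (m * ts.P s i k)) =
      ENNReal.ofReal (ts.P s i k) * ENNReal.ofReal (Real.negMulLog m) +
        ENNReal.ofReal m * ENNReal.ofReal (Real.negMulLog (ts.P s i k)) := by
    intro k
    have hP0 := hts.1 s i k
    have hP1 := P_le_one hts s i k
    have a := Real.negMulLog_nonneg h0 h1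
    have b := Real.negMulLog_nonneg hP0 hP1
    rw [Real.negMulLog_mul, ENNReal.ofReal_add (mul_nonneg hP0 a) (mul_nonneg h0 b),
      ENNReal.ofReal_mul hP0, ENNReal.ofReal_mul h0]
  simp_rw [e]
  rw [ENNReal.tsum_add, ENNReal.tsum_mul_right, ENNReal.tsum_mul_left, tsum_P hts, one_mul]

lemma joint_entropy {ts : TransSys r K} (hts : ts.IsInvariant) (s : Fin r × Bool) :
    ∑' jk : K × K, ENNReal.ofReal (Real.negMulLog (ts.pi jk.1 * ts.P s jk.1 jk.2)) =
      ∑' i, ENNReal.ofReal (Real.negMulLog (ts.pi i)) + hstep ts s := by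
  rw [ENNReal.tsum_prod', hstep, ← ENNReal.tsum_add]
  apply tsum_congr
  intro i
  exact tsum_row hts s i _ (hts.2.2.1 i) (pi_le_one hts i)

lemma hstep_inv {ts : TransSys r K} (hts : ts.IsInvariant) (i : Fin r)
    (hfin : ∑' i, ENNReal.ofReal (Real.negMulLog (ts.pi i)) ≠ ⊤) :
    hstep ts (i, false) = hstep ts (i, true) := by
  have h1 := joint_entropy hts (i, false)
  have h2 := joint_entropy hts (i, true)
  have h3 : ∑' jk : K × K, ENNReal.ofReal (Real.negMulLog (ts.pi jk.1 * ts.P (i, false) jk.1 jk.2))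
      = ∑' jk : K × K, ENNReal.ofReal (Real.negMulLog (ts.pi jk.1 * ts.P (i, true) jk.1 jk.2)) := by
    rw [← (Equiv.prodComm K K).tsum_eq]
    apply tsum_congr
    rintro ⟨a, b⟩
    have := hts.2.2.2.2.2 (i, true) b a
    simp only [Bool.not_true] at this
    simp [this]
  rw [h1, h2] at h3
  exact (ENNReal.add_right_inj hfin).mp h3

variable [MeasurableSpace K] [DiscreteMeasurableSpace K] [Countable K]
  {μ : Measure (FG r → K)} [IsProbabilityMeasure μ]

lemma tsum_preimage {X L : Type*} [MeasurableSpace X] [MeasurableSpace L]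
    [MeasurableSingletonClass L] [Countable L] (μ : Measure X) (p : X → L) (hp : Measurable p)
    (φ : L → ℝ≥0∞) : ∑' l, φ l * μ (p ⁻¹' {l}) = ∫⁻ x, φ (p x) ∂μ := by
  have hφ : Measurable φ := measurable_of_countable φ
  rw [← lintegral_map hφ hp, lintegral_countable']
  apply tsum_congr
  intro l
  rw [Measure.map_apply hp (measurableSet_singleton l)]

lemma marginal {ts : TransSys r K} (hts : ts.IsInvariant) (hμ : IsInducedBy μ ts) :
    ∀ (n : ℕ) (g : FG r), FreeGroup.norm g = n → ∀ k,
      μ {x | x g = k} = ENNReal.ofReal (ts.pi k) := by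
  intro n
  induction n with
  | zero =>
    intro g hg k
    rw [FreeGroup.norm_eq_zero] at hg
    subst hg
    exact hμ.1 k
  | succ n ih =>
    intro g' hg' k
    obtain ⟨s, g, rfl, hn⟩ := exists_parent (h := g') (by rintro rfl; simp at hg')
    have h1 : ∀ k₀, μ ({x | x (gen s * g) = k} ∩ {x | x g = k₀})
        = ENNReal.ofReal (ts.P s k₀ k) * ENNReal.ofReal (ts.pi k₀) := by
      intro k₀
      rw [((hμ.2 s g hn 0 Fin.elim0 Fin.elim0 k₀ k) (fun i => i.elim0)).2, ih g (by omega)]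
    rw [← tsum_pi_P hts s k]
    simp_rw [← h1]
    rw [← measure_iUnion]
    · congr 1
      ext x
      simp
    · intro a b hab
      simp only [Function.onFun, Set.disjoint_left]
      rintro x ⟨_, hx⟩ ⟨_, hx'⟩
      exact hab (hx.symm.trans hx')
    · intro k₀
      have hm : ∀ (u : FG r) (c : K), MeasurableSet {x : FG r → K | x u = c} := fun u c =>
        (measurable_pi_apply (X := fun _ : FG r => K) u) (measurableSet_singleton c)
      exact (hm _ _).inter (hm _ _)

/-- Entropy of the restriction to a finite set. -/
def HF (μ : Measure (FG r → K)) (F : Finset (FG r)) : ℝ≥0∞ :=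
  Hpart μ (fun (x : FG r → K) (q : F) => x q)

lemma HF_insert {ts : TransSys r K} (hts : ts.IsInvariant) (hμ : IsInducedBy μ ts)
    (F : Finset (FG r)) (s : Fin r × Bool) (g : FG r) (hg : g ∈ F)
    (hn : FreeGroup.norm (gen s * g) = FreeGroup.norm g + 1)
    (hF : ∀ f ∈ F, f ∈ Past (gen s * g) g) :
    HF μ (insert (gen s * g) F) = HF μ F + hstep ts s := by
  let res : (FG r → K) → (F → K) := fun x q => x q
  have hres : Measurable res := by
    rw [measurable_pi_iff]; intro q; exact measurable_pi_apply _
  -- relabel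
  let ι : (↥(insert (gen s * g) F) → K) → (F → K) × K :=
    fun a => (fun q => a ⟨q, Finset.mem_insert_of_mem q.2⟩, a ⟨gen s * g, Finset.mem_insert_self _ _⟩)
  have hι : Function.Injective ι := by
    intro a b hab
    funext ⟨q, hq⟩
    rcases Finset.mem_insert.mp hq with h | h
    · subst h
      exact congrArg Prod.snd hab
    · exact congrFun (congrArg Prod.fst hab) ⟨q, h⟩
  have e1 : HF μ (insert (gen s * g) F) = Hpart μ (fun x => (res x, x (gen s * g))) := by
    rw [HF, ← Hpart_comp μ _ ι hι]
  -- transition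
  have e2 : ∀ (a : F → K) (k : K), μ ((fun x => (res x, x (gen s * g))) ⁻¹' {(a, k)}) =
      ENNReal.ofReal (ts.P s (a ⟨g, hg⟩) k) * μ (res ⁻¹' {a}) := by
    intro a k
    let e := (F.erase g).equivFin.symm
    have hmem : ∀ i, (e i : FG r) ∈ F := fun i => Finset.mem_of_mem_erase (e i).2
    have h := ((hμ.2 s g hn _ (fun i => (e i : FG r)) (fun i => a ⟨e i, hmem i⟩) (a ⟨g, hg⟩) k)
      (fun i => ⟨hF _ (hmem i), Finset.ne_of_mem_erase (e i).2⟩)).1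
    have hset : res ⁻¹' {a} = {x | x g = a ⟨g, hg⟩} ∩ ⋂ i, {x | x (e i) = a ⟨e i, hmem i⟩} := by
      ext x
      simp only [Set.mem_preimage, Set.mem_singleton_iff, Set.mem_inter_iff, Set.mem_setOf_eq,
        Set.mem_iInter]
      constructor
      · rintro rfl
        exact ⟨rfl, fun i => rfl⟩
      · rintro ⟨h1, h2⟩
        funext ⟨q, hq⟩
        by_cases hqg : q = g
        · subst hqg; exact h1
        · have := h2 (e.symm ⟨q, Finset.mem_erase.mpr ⟨hqg, hq⟩⟩)
          simpa using this
    rw [hset, ← h, ← hset]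
    congr 1
    ext x
    simp [and_comm]
  rw [e1, Hpart, ENNReal.tsum_prod']
  have e3 : ∀ a : F → K, ∑' k, ENNReal.ofReal (Real.negMulLog
      (μ ((fun x => (res x, x (gen s * g))) ⁻¹' {(a, k)})).toReal) =
      ENNReal.ofReal (Real.negMulLog (μ (res ⁻¹' {a})).toReal) +
        (∑' k, ENNReal.ofReal (Real.negMulLog (ts.P s (a ⟨g, hg⟩) k))) * μ (res ⁻¹' {a}) := by
    intro a
    have h := tsum_row hts s (a ⟨g, hg⟩) (μ (res ⁻¹' {a})).toReal ENNReal.toReal_nonneg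
      (ENNReal.toReal_le_of_le_ofReal zero_le_one (by simpa using prob_le_one))
    rw [ENNReal.ofReal_toReal (measure_ne_top _ _)] at h
    rw [mul_comm _ (μ (res ⁻¹' {a})), ← h]
    apply tsum_congr
    intro k
    rw [e2, ENNReal.toReal_mul, ENNReal.toReal_ofReal (hts.1 _ _ _), mul_comm]
  simp_rw [e3]
  rw [ENNReal.tsum_add]
  congr 1
  have e4 := tsum_preimage μ res hres
    (fun a => ∑' k, ENNReal.ofReal (Real.negMulLog (ts.P s (a ⟨g, hg⟩) k)))
  have e5 := tsum_preimage μ (fun x : FG r → K => x g) (measurable_pi_apply g)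
    (fun i => ∑' k, ENNReal.ofReal (Real.negMulLog (ts.P s i k)))
  rw [e4]
  refine Eq.trans e5.symm ?_
  rw [hstep]
  apply tsum_congr
  intro i
  rw [mul_comm]
  congr 1
  exact marginal hts hμ _ g rfl i

lemma HF_one {ts : TransSys r K} (hμ : IsInducedBy μ ts) (hts : ts.IsInvariant) :
    HF μ ({1} : Finset (FG r)) = ∑' i, ENNReal.ofReal (Real.negMulLog (ts.pi i)) := by
  have h : Hpart μ (fun x : FG r → K => x 1) = HF μ ({1} : Finset (FG r)) := by
    rw [HF]
    rw [← Hpart_comp μ _ (fun (a : ↥({1} : Finset (FG r)) → K) => a ⟨1, by simp⟩)]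
    intro a b hab
    funext ⟨q, hq⟩
    have := Finset.mem_singleton.mp hq
    subst this
    exact hab
  rw [← h, Hpart]
  apply tsum_congr
  intro k
  have : (fun x : FG r → K => x 1) ⁻¹' {k} = {x | x 1 = k} := rfl
  rw [this, hμ.1, ENNReal.toReal_ofReal (hts.2.2.1 k)]

/-- closed under parents -/
def PClosed (F : Finset (FG r)) : Prop :=
  1 ∈ F ∧ ∀ h ∈ F, h ≠ 1 → ∃ s, ∃ g ∈ F, h = gen s * g ∧ FreeGroup.norm h = FreeGroup.norm g + 1

lemma HF_eq {ts : TransSys r K} (hts : ts.IsInvariant) (hμ : IsInducedBy μ ts)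
    (hfin : ∑' i, ENNReal.ofReal (Real.negMulLog (ts.pi i)) ≠ ⊤) :
    ∀ (n : ℕ) (F : Finset (FG r)), F.card = n → PClosed F →
    HF μ F = ∑' i, ENNReal.ofReal (Real.negMulLog (ts.pi i)) +
      ∑ g ∈ F, wt (fun i => hstep ts (i, true)) g := by
  intro n
  induction n with
  | zero =>
    intro F hc hF
    rw [Finset.card_eq_zero] at hc
    rw [hc] at hF
    simp [PClosed] at hF
  | succ n ih =>
    intro F hc hF
    obtain ⟨u, hu, hmax⟩ := F.exists_max_image FreeGroup.norm ⟨1, hF.1⟩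
    by_cases hu1 : u = 1
    · have : F = {1} := by
        ext q
        rw [Finset.mem_singleton]
        constructor
        · intro hq
          have := hmax q hq
          rw [hu1, FreeGroup.norm_one, Nat.le_zero, FreeGroup.norm_eq_zero] at this
          exact this
        · rintro rfl; exact hF.1
      rw [this, HF_one hμ hts]
      simp [wt_one]
    · obtain ⟨s, g, hg, hug, hn⟩ := hF.2 u hu hu1
      have hgne : g ≠ u := by
        rintro rfl; omega
      have hE : PClosed (F.erase u) := by
        refine ⟨Finset.mem_erase.mpr ⟨Ne.symm hu1, hF.1⟩, ?_⟩
        intro h hh hh1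
        obtain ⟨t, g', hg', e, hn'⟩ := hF.2 h (Finset.mem_of_mem_erase hh) hh1
        refine ⟨t, g', Finset.mem_erase.mpr ⟨?_, hg'⟩, e, hn'⟩
        rintro rfl
        have := hmax h (Finset.mem_of_mem_erase hh)
        omega
      have hi : insert (gen s * g) (F.erase u) = F := by
        rw [← hug]; exact Finset.insert_erase hu
      have h1 := HF_insert hts hμ (F.erase u) s g (Finset.mem_erase.mpr ⟨hgne, hg⟩)
        (by rw [← hug]; exact hn) (by
          intro f hf
          apply mem_past
          · rw [← hug]; exact hn
          · rw [← hug]; exact hmax f (Finset.mem_of_mem_erase hf)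
          · rw [← hug]; exact Finset.ne_of_mem_erase hf)
      rw [hi] at h1
      rw [h1, ih _ (by rw [Finset.card_erase_of_mem hu, hc]; rfl) hE, ← Finset.sum_erase_add F _ hu,
        add_assoc]
      congr 2
      rw [hug, wt_gen_mul _ (by rw [← hug]; exact hn)]
      rcases s with ⟨i, b⟩
      cases b
      · exact hstep_inv hts i hfin
      · rfl

end Step
/-- the `f`-invariant of a Markov chain induced by an invariant
transition system `({P^s},π)`:
`f = (2r−1)∑ᵢ πᵢ log πᵢ − ∑_{s∈S₊} ∑_{i,j} πᵢP^s_{ij} log(πᵢP^s_{ij})`. -/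
theorem stmt_13 {r : ℕ} (hr : 1 ≤ r) {K : Type*} [MeasurableSpace K]
    [DiscreteMeasurableSpace K] [Countable K]
    (ts : TransSys r K) (hts : ts.IsInvariant)
    (μ : Measure (FG r → K)) [IsProbabilityMeasure μ] (hμ : IsInducedBy μ ts)
    (hH : Hpart μ (fun x : FG r → K => x 1) < ⊤)
    (hsum1 : Summable (fun i : K => ts.pi i * Real.log (ts.pi i)))
    (hsum2 : ∀ i : Fin r, Summable (fun jk : K × K =>
        ts.pi jk.1 * ts.P (i, true) jk.1 jk.2 *
          Real.log (ts.pi jk.1 * ts.P (i, true) jk.1 jk.2))) :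
    littleF shiftT μ (fun x : FG r → K => x 1)
      = (((2 * (r : ℝ) - 1) * ∑' i : K, ts.pi i * Real.log (ts.pi i)
          - ∑ i : Fin r, ∑' jk : K × K,
              ts.pi jk.1 * ts.P (i, true) jk.1 jk.2 *
                Real.log (ts.pi jk.1 * ts.P (i, true) jk.1 jk.2) : ℝ) : EReal) := by
  classical
  obtain ⟨-, -, hpi0, -, -, -⟩ := id hts
  set H : ℝ≥0∞ := ∑' i, ENNReal.ofReal (Real.negMulLog (ts.pi i)) with hHdef
  have nn1 : ∀ i, 0 ≤ Real.negMulLog (ts.pi i) := fun i =>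
    Real.negMulLog_nonneg (hpi0 i) (pi_le_one hts i)
  have eq1 : (fun i => Real.negMulLog (ts.pi i)) = fun i => -(ts.pi i * Real.log (ts.pi i)) := by
    funext i; simp [Real.negMulLog]
  have s1 : Summable (fun i => Real.negMulLog (ts.pi i)) := by rw [eq1]; exact hsum1.neg
  have hH1 : H = ENNReal.ofReal (∑' i, Real.negMulLog (ts.pi i)) :=
    (ENNReal.ofReal_tsum_of_nonneg nn1 s1).symm
  have hHfin : H ≠ ⊤ := by rw [hH1]; exact ENNReal.ofReal_ne_top
  have hHr : H.toReal = - ∑' i, ts.pi i * Real.log (ts.pi i) := by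
    rw [hH1, ENNReal.toReal_ofReal (tsum_nonneg nn1), eq1, tsum_neg]
  have eq2 : ∀ i : Fin r, (fun jk : K × K => Real.negMulLog (ts.pi jk.1 * ts.P (i, true) jk.1 jk.2))
      = fun jk : K × K => -(ts.pi jk.1 * ts.P (i, true) jk.1 jk.2 *
          Real.log (ts.pi jk.1 * ts.P (i, true) jk.1 jk.2)) := by
    intro i; funext jk; simp [Real.negMulLog]
  have nn2 : ∀ (i : Fin r) (jk : K × K),
      0 ≤ Real.negMulLog (ts.pi jk.1 * ts.P (i, true) jk.1 jk.2) := fun i jk =>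
    Real.negMulLog_nonneg (mul_nonneg (hpi0 _) (hts.1 _ _ _))
      (mul_le_one₀ (pi_le_one hts _) (hts.1 _ _ _) (P_le_one hts _ _ _))
  have s2 : ∀ i : Fin r, Summable
      (fun jk : K × K => Real.negMulLog (ts.pi jk.1 * ts.P (i, true) jk.1 jk.2)) := by
    intro i; rw [eq2]; exact (hsum2 i).neg
  have hJ : ∀ i : Fin r, H + hstep ts (i, true) = ENNReal.ofReal
      (∑' jk : K × K, Real.negMulLog (ts.pi jk.1 * ts.P (i, true) jk.1 jk.2)) := by
    intro i
    rw [ENNReal.ofReal_tsum_of_nonneg (nn2 i) (s2 i), joint_entropy hts]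
  have hstep_fin : ∀ i, hstep ts (i, true) ≠ ⊤ := by
    intro i h
    have := hJ i
    rw [h, add_top] at this
    exact ENNReal.ofReal_ne_top this.symm
  have hJr : ∀ i : Fin r, H.toReal + (hstep ts (i, true)).toReal =
      - ∑' jk : K × K, ts.pi jk.1 * ts.P (i, true) jk.1 jk.2 *
          Real.log (ts.pi jk.1 * ts.P (i, true) jk.1 jk.2) := by
    intro i
    rw [← ENNReal.toReal_add hHfin (hstep_fin i), hJ, ENNReal.toReal_ofReal (tsum_nonneg (nn2 i)),
      eq2, tsum_neg]
  have wfin : ∀ g : FG r, wt (fun i => hstep ts (i, true)) g ≠ ⊤ := by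
    intro g
    unfold wt
    split
    · simp
    · exact hstep_fin _
  have wreal : ∀ g : FG r, (wt (fun i => hstep ts (i, true)) g).toReal =
      wt (fun i => (hstep ts (i, true)).toReal) g := by
    intro g
    unfold wt
    split <;> simp
  have HFr : ∀ F : Finset (FG r), PClosed F → (HF μ F).toReal =
      H.toReal + ∑ g ∈ F, wt (fun i => (hstep ts (i, true)).toReal) g := by
    intro F hF
    rw [HF_eq hts hμ hHfin _ F rfl hF, ENNReal.toReal_add hHfin
      (ENNReal.sum_ne_top.mpr fun g _ => wfin g), ENNReal.toReal_sum fun g _ => wfin g]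
    simp_rw [wreal]
  have main : ∀ n : ℕ, FF shiftT μ (pow shiftT (fun x : FG r → K => x 1) (n + 1)) =
      (2 * (r : ℝ) - 1) * ∑' i : K, ts.pi i * Real.log (ts.pi i)
          - ∑ i : Fin r, ∑' jk : K × K,
              ts.pi jk.1 * ts.P (i, true) jk.1 jk.2 *
                Real.log (ts.pi jk.1 * ts.P (i, true) jk.1 jk.2) := by
    intro n
    have a1 : Hpart μ (pow shiftT (fun x : FG r → K => x 1) (n + 1)) = HF μ (bf r (n+1)) := by
      rw [HF, ← Hpart_comp μ _ (fun (a : ↥(bf r (n+1)) → K) (q : ball r (n+1)) =>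
        a ⟨q, mem_bf.mpr q.2⟩)]
      · congr 1
        funext x q
        simp [pow, powS, shiftT]
      · intro a b hab
        funext ⟨q, hq⟩
        exact congrFun hab ⟨q, mem_bf.mp hq⟩
    have a2 : ∀ j : Fin r, Hpart μ (pjoin (pow shiftT (fun x : FG r → K => x 1) (n + 1))
        (pull shiftT (FreeGroup.of j) (pow shiftT (fun x : FG r → K => x 1) (n + 1)))) =
        HF μ (bf r (n+1) ∪ (bf r (n+1)).image (fun q => q * gen (j, true))) := by
      intro j
      rw [HF, ← Hpart_comp μ _ (fun (a : ↥(bf r (n+1) ∪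
          (bf r (n+1)).image (fun q => q * gen (j, true))) → K) =>
        ((fun (q : ball r (n+1)) => a ⟨q, Finset.mem_union_left _ (mem_bf.mpr q.2)⟩),
         (fun (q : ball r (n+1)) => a ⟨q * gen (j, true), Finset.mem_union_right _
            (Finset.mem_image_of_mem _ (mem_bf.mpr q.2))⟩)))]
      · congr 1
        funext x
        refine Prod.ext ?_ ?_
        · funext q
          simp [pjoin, pow, powS, shiftT]
        · funext q
          simp [pjoin, pull, pow, powS, shiftT, gen]
      · intro a b hab
        funext ⟨q, hq⟩
        rcases Finset.mem_union.mp hq with h | h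
        · exact congrFun (congrArg Prod.fst hab) ⟨q, mem_bf.mp h⟩
        · obtain ⟨q', hq', rfl⟩ := Finset.mem_image.mp h
          exact congrFun (congrArg Prod.snd hab) ⟨q', mem_bf.mp hq'⟩
    have p1 : PClosed (bf r (n+1)) := by
      refine ⟨by simp [mem_bf], fun h hh hh1 => ?_⟩
      obtain ⟨s, g, e, hn⟩ := exists_parent hh1
      rw [mem_bf] at hh
      exact ⟨s, g, mem_bf.mpr (by omega), e, hn⟩
    have u1 : ∀ j : Fin r, bf r (n+1) ∪ (bf r (n+1)).image (fun q => q * gen (j, true)) =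
        bf r (n+1) ∪ lf r (n+1) j := by
      intro j
      ext g
      simp only [Finset.mem_union, Finset.mem_image, mem_bf, mem_lf]
      constructor
      · rintro (h | ⟨q, hq, rfl⟩)
        · exact Or.inl h
        · have := norm_mul_gen (j, true) q
          rw [mul_inv_cancel_right]
          omega
      · rintro (h | h)
        · exact Or.inl h
        · exact Or.inr ⟨g * (gen (j, true))⁻¹, by omega, by simp⟩
    have p2 : ∀ j : Fin r, PClosed (bf r (n+1) ∪ lf r (n+1) j) := by
      intro j
      refine ⟨Finset.mem_union_left _ p1.1, fun h hh hh1 => ?_⟩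
      rcases Finset.mem_union.mp hh with hh | hh
      · obtain ⟨s, g, hg, e⟩ := p1.2 h hh hh1
        exact ⟨s, g, Finset.mem_union_left _ hg, e⟩
      · obtain ⟨s, g, e, hn⟩ := exists_parent hh1
        rw [mem_lf] at hh
        exact ⟨s, g, Finset.mem_union_left _ (mem_bf.mpr (by omega)), e, hn⟩
    have d : ∀ j : Fin r, Disjoint (bf r (n+1)) (lf r (n+1) j) := by
      intro j
      rw [Finset.disjoint_left]
      intro g
      rw [mem_bf, mem_lf]
      omega
    rw [FF, a1, HFr _ p1]
    simp_rw [a2, u1]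
    have a3 : ∀ j : Fin r, (HF μ (bf r (n+1) ∪ lf r (n+1) j)).toReal = H.toReal +
        (∑ g ∈ bf r (n+1), wt (fun i => (hstep ts (i, true)).toReal) g +
          ∑ g ∈ lf r (n+1) j, wt (fun i => (hstep ts (i, true)).toReal) g) := by
      intro j
      rw [HFr _ (p2 j), Finset.sum_union (d j)]
    have a4 : ∑ i : Fin r, ∑' jk : K × K, ts.pi jk.1 * ts.P (i, true) jk.1 jk.2 *
          Real.log (ts.pi jk.1 * ts.P (i, true) jk.1 jk.2) =
        - (r * H.toReal + ∑ i : Fin r, (hstep ts (i, true)).toReal) := by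
      have : ∀ i : Fin r, ∑' jk : K × K, ts.pi jk.1 * ts.P (i, true) jk.1 jk.2 *
          Real.log (ts.pi jk.1 * ts.P (i, true) jk.1 jk.2) =
          - (H.toReal + (hstep ts (i, true)).toReal) := by
        intro i; rw [hJr i, neg_neg]
      simp_rw [this]
      rw [Finset.sum_neg_distrib, Finset.sum_add_distrib]
      simp
    have a5 : ∑' i : K, ts.pi i * Real.log (ts.pi i) = - H.toReal := by rw [hHr, neg_neg]
    simp_rw [a3]
    rw [a4, a5, Finset.sum_add_distrib, Finset.sum_add_distrib, sum_last]
    simp only [Finset.sum_const, Finset.card_univ, Fintype.card_fin, nsmul_eq_mul]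
    ring
  unfold littleF
  simp_rw [main]
  exact ciInf_const

end

end Bowen
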